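/- Let α = (α_1, …, α_n) be an n-tuple of pairwise independent irrational numbers. Then there exists T > 0 such that for all t > T, the number τ(t) of indices j ∈ {1, …, n} for which ψ_{α_j} is discontinuous at t satisfies τ(t) ≤ k(α). -/

import Mathlib

/-- Distance from `x` to the nearest integer. -/
noncomputable def distToInt (x : ℝ) : ℝ := |x - round x|

/-- The irrationality measure function `ψ_α(t) = min_{1 ≤ q ≤ t} ‖qα‖`. -/
noncomputable def psi (α : ℝ) (t : ℝ) : ℝ :=
  sInf ((fun q : ℤ => distToInt ((q : ℝ) * α)) '' {q : ℤ | 1 ≤ q ∧ (q : ℝ) ≤ t})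

/-- An `n`-tuple is pairwise independent if eventually all the values
`ψ_{α_i}(t)` are pairwise distinct. -/
def PairwiseIndependent {n : ℕ} (α : Fin n → ℝ) : Prop :=
  ∃ T : ℝ, 0 ≤ T ∧ ∀ t : ℝ, T ≤ t → ∀ i j : Fin n, i ≠ j → psi (α i) t ≠ psi (α j) t

/-- `v : Fin n → Fin n` is the order vector of `α` at time `t`:
`ψ_{α_{v 0}}(t) > ψ_{α_{v 1}}(t) > … > ψ_{α_{v (n-1)}}(t)`. -/
def IsOrderVec {n : ℕ} (α : Fin n → ℝ) (t : ℝ) (v : Fin n → Fin n) : Prop :=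
  Function.Bijective v ∧
    ∀ p q : Fin n, p < q → psi (α (v p)) t > psi (α (v q)) t

/-- The order vector `v` occurs at arbitrarily large times. -/
def OccursInfinitely {n : ℕ} (α : Fin n → ℝ) (v : Fin n → Fin n) : Prop :=
  ∀ T : ℝ, ∃ t : ℝ, T < t ∧ IsOrderVec α t v

/-- `k(α)`: the number of distinct order vectors occurring for arbitrarily large `t`. -/
noncomputable def kAlpha {n : ℕ} (α : Fin n → ℝ) : ℕ :=
  Nat.card {v : Fin n → Fin n | OccursInfinitely α v}

/-- The relative order of the functions `ψ_{α_i}` is the same at times `t` and `t'`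
(i.e. the order vectors coincide). -/
def SameOrder {n : ℕ} (α : Fin n → ℝ) (t t' : ℝ) : Prop :=
  ∀ i j : Fin n, (psi (α i) t < psi (α j) t ↔ psi (α i) t' < psi (α j) t')

/-- `ts` is a sequence of moments of permutation changes:
`ts (i+1) = min { t > ts i : v_α(t) ≠ v_α(ts i) }`. -/
def IsChangeSeq {n : ℕ} (α : Fin n → ℝ) (ts : ℕ → ℝ) : Prop :=
  ∀ i : ℕ, IsLeast {t : ℝ | ts i < t ∧ ¬ SameOrder α (ts i) t} (ts (i + 1))

/-- The set of positions `(j,l)`, `1 ≤ j ≤ l ≤ k` (here `0`-based). -/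
def PairIdx (k : ℕ) := {p : Fin k × Fin k // p.1 ≤ p.2}

/-- Construct a position from `0`-based indices `j ≤ l < k`. -/
def mkPos {k : ℕ} (j l : ℕ) (hj : j ≤ l) (hl : l < k) : PairIdx k :=
  ⟨(⟨j, lt_of_le_of_lt hj hl⟩, ⟨l, hl⟩), Fin.mk_le_mk.mpr hj⟩

/-- The position permutation underlying `π`: one has `π(u) = u ∘ tau`.
In `1`-based notation: `tau (i,i) = (i+1,i+1)` for `i < k`, `tau (k,k) = (1,1)`,
`tau (i,k) = (1,i+1)` for `i < k`, and `tau (i,j) = (i+1,j+1)` otherwise. -/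
def tau {k : ℕ} (p : PairIdx k) : PairIdx k :=
  if h2 : p.1.2.val = k - 1 then
    if h1 : p.1.1.val = k - 1 then
      ⟨(⟨0, by have := p.1.2.isLt; omega⟩, ⟨0, by have := p.1.2.isLt; omega⟩), le_refl _⟩
    else
      ⟨(⟨0, by have := p.1.2.isLt; omega⟩,
        ⟨p.1.1.val + 1, by have := p.1.1.isLt; omega⟩),
       Fin.mk_le_mk.mpr (by omega)⟩
  else
    ⟨(⟨p.1.1.val + 1, by have h := p.1.2.isLt; have h' : p.1.1.val ≤ p.1.2.val := p.2; omega⟩,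
      ⟨p.1.2.val + 1, by have h := p.1.2.isLt; omega⟩),
     Fin.mk_le_mk.mpr (by have h' : p.1.1.val ≤ p.1.2.val := p.2; omega)⟩

/-- The action of `π` on vectors indexed by positions: `π(u) = u ∘ tau`. -/
def piMap {k : ℕ} {X : Type*} (u : PairIdx k → X) : PairIdx k → X :=
  fun p => u (tau p)

/-- The (`0`-based) linear position of the pair `(j,l)` in the special enumeration
`u_{1,1}, u_{1,k}, u_{1,k-1}, …, u_{1,2}, u_{2,2}, u_{2,k}, …, u_{k,k}`. -/
def posIdx {k : ℕ} (p : PairIdx k) : ℕ :=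
  (p.1.1.val * k - p.1.1.val * (p.1.1.val - 1) / 2) +
    (if p.1.2.val = p.1.1.val then 0 else k - p.1.2.val)

/-- `v : PairIdx k → Fin n` is the order vector of `α` at time `t`, written in the
special pair enumeration: the function at position `p` is larger than the one at
position `q` whenever `p` precedes `q` in the enumeration. -/
def IsOrderVecP {n k : ℕ} (α : Fin n → ℝ) (t : ℝ) (v : PairIdx k → Fin n) : Prop :=
  Function.Bijective v ∧
    ∀ p q : PairIdx k, posIdx p < posIdx q → psi (α (v p)) t > psi (α (v q)) t

/-- Denominator `q_m` of the `m`-th convergent of the continued fraction of `α`. -/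
noncomputable def cfDen (α : ℝ) (m : ℕ) : ℝ := (GenContFract.of α).dens m

/-- The orbit equivalence relation of the map `tau` on positions. -/
def orbitSetoid (k : ℕ) : Setoid (PairIdx k) where
  r p q := ∃ a b : ℕ, (fun x : PairIdx k => tau x)^[a] p = (fun x : PairIdx k => tau x)^[b] q
  iseqv := by
    constructor
    · exact fun p => ⟨0, 0, rfl⟩
    · rintro p q ⟨a, b, h⟩; exact ⟨b, a, h.symm⟩
    · rintro p q r ⟨a, b, h1⟩ ⟨c, d, h2⟩
      refine ⟨c + a, b + d, ?_⟩
      rw [Function.iterate_add_apply, h1, ← Function.iterate_add_apply,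
        Nat.add_comm c b, Function.iterate_add_apply, h2, ← Function.iterate_add_apply]

/-- The signed distance from `q * α` to the nearest integer. -/
noncomputable def err (α : ℝ) (q : ℕ) : ℝ := (q : ℝ) * α - round ((q : ℝ) * α)

/-- `q` is a best approximation denominator of `α`: a point where `ψ_α` drops. -/
def IsRecord (α : ℝ) (q : ℕ) : Prop :=
  1 ≤ q ∧ ∀ s : ℕ, 1 ≤ s → s < q → |err α q| < |err α s|

/-- `p` is the last best approximation denominator of `α` below `t`. -/
def IsLastRecord (α : ℝ) (p t : ℕ) : Prop :=
  IsRecord α p ∧ p < t ∧ ∀ s : ℕ, 1 ≤ s → s < t → |err α p| ≤ |err α s|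

lemma err_ne_zero {α : ℝ} (h : Irrational α) {q : ℕ} (hq : 1 ≤ q) : err α q ≠ 0 := by
  have h1 : Irrational ((q : ℝ) * α) := h.natCast_mul (by omega)
  exact sub_ne_zero.mpr (h1.ne_int _)

lemma abs_err_pos {α : ℝ} (h : Irrational α) {q : ℕ} (hq : 1 ≤ q) : 0 < |err α q| :=
  abs_pos.mpr (err_ne_zero h hq)

lemma abs_err_le (α : ℝ) (q : ℕ) (z : ℤ) : |err α q| ≤ |(q : ℝ) * α - z| :=
  round_le _ _

lemma abs_err_le_half (α : ℝ) (q : ℕ) : |err α q| ≤ 1 / 2 := abs_sub_round _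

lemma exists_abs_err_mul_le (α : ℝ) {t : ℕ} (ht : 2 ≤ t) :
    ∃ s : ℕ, 1 ≤ s ∧ s < t ∧ |err α s| * t ≤ 1 := by
  obtain ⟨j, k, hk, hkn, h⟩ := Real.exists_int_int_abs_mul_sub_le α (n := t - 1) (by omega)
  lift k to ℕ using hk.le
  refine ⟨k, by omega, by omega, ?_⟩
  have h1 := (abs_err_le α k j).trans (by simpa using h)
  have ht' : (0 : ℝ) < t := by positivity
  rw [Nat.cast_sub (by omega)] at h1
  calc |err α k| * t ≤ (t : ℝ)⁻¹ * t := by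
        gcongr; simpa using h1
    _ = 1 := inv_mul_cancel₀ ht'.ne'

lemma IsLastRecord.abs_err_mul_le {α : ℝ} {p t : ℕ} (h : IsLastRecord α p t) :
    |err α p| * t ≤ 1 := by
  obtain ⟨s, hs, hst, hle⟩ := exists_abs_err_mul_le α (t := t) (by have := h.1.1; have := h.2.1; omega)
  exact (mul_le_mul_of_nonneg_right (h.2.2 s hs hst) (by positivity)).trans hle

lemma exists_isLastRecord (α : ℝ) {t : ℕ} (ht : 2 ≤ t) : ∃ p, IsLastRecord α p t := by
  classical
  have hex : ∃ p : ℕ, (1 ≤ p ∧ p < t) ∧ ∀ s : ℕ, 1 ≤ s → s < t → |err α p| ≤ |err α s| := by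
    obtain ⟨p, hp, h⟩ := Finset.exists_min_image (Finset.Ico 1 t) (fun s => |err α s|)
      ⟨1, by simp; omega⟩
    exact ⟨p, by simpa using hp, fun s h1 h2 => h s (by simp; omega)⟩
  have hspec := Nat.find_spec hex
  refine ⟨Nat.find hex, ⟨hspec.1.1, fun s h1 h2 => ?_⟩, hspec.1.2, hspec.2⟩
  by_contra! hc
  exact Nat.find_min hex h2 ⟨⟨h1, h2.trans hspec.1.2⟩, fun r hr hrt => hc.trans (hspec.2 r hr hrt)⟩

lemma IsLastRecord.le_of_isRecord {α : ℝ} {p q t : ℕ} (h : IsLastRecord α p t)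
    (hq : IsRecord α q) (hqt : q < t) : q ≤ p := by
  by_contra! hc
  exact absurd (hq.2 p h.1.1 hc) (not_lt.mpr (h.2.2 q hq.1 hqt))

lemma exists_abs_err_lt (α : ℝ) {ε : ℝ} (hε : 0 < ε) : ∃ s : ℕ, 1 ≤ s ∧ |err α s| < ε := by
  obtain ⟨N, hN⟩ := exists_nat_gt (1 / ε)
  obtain ⟨s, hs, -, h⟩ := exists_abs_err_mul_le α (t := N + 2) (by omega)
  refine ⟨s, hs, ?_⟩
  rw [div_lt_iff₀ hε] at hN
  push_cast at h
  by_contra! hc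
  nlinarith

lemma exists_next_record {α : ℝ} (hα : Irrational α) {p : ℕ} (hp : IsRecord α p) :
    ∃ q, IsLastRecord α p q ∧ IsRecord α q := by
  classical
  have hex : ∃ q : ℕ, 1 ≤ q ∧ |err α q| < |err α p| := exists_abs_err_lt α (abs_err_pos hα hp.1)
  have hspec := Nat.find_spec hex
  have hmin : ∀ s : ℕ, 1 ≤ s → s < Nat.find hex → |err α p| ≤ |err α s| := fun s h1 h2 => by
    have := Nat.find_min hex h2
    push Not at this
    exact this h1
  have hlt : p < Nat.find hex := by
    rcases lt_trichotomy p (Nat.find hex) with h | h | h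
    · exact h
    · rw [← h] at hspec; exact absurd hspec.2 (lt_irrefl _)
    · exact absurd (hp.2 _ hspec.1 h) (not_lt.mpr hspec.2.le)
  exact ⟨_, ⟨hp, hlt, hmin⟩, hspec.1, fun s h1 h2 => hspec.2.trans_le (hmin s h1 h2)⟩

lemma exists_record_ge {α : ℝ} (hα : Irrational α) (N : ℕ) : ∃ q, N ≤ q ∧ IsRecord α q := by
  induction N with
  | zero => exact ⟨1, by omega, le_rfl, fun s h1 h2 => by omega⟩
  | succ N ih =>
    obtain ⟨q, hq, hr⟩ := ih
    obtain ⟨r, h1, h2⟩ := exists_next_record hα hr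
    exact ⟨r, by have := h1.2.1; omega, h2⟩

lemma exists_int_det (α : ℝ) (p q : ℕ) : ∃ z : ℤ, err α p * q - err α q * p = z := by
  refine ⟨round ((q : ℝ) * α) * p - round ((p : ℝ) * α) * q, ?_⟩
  simp only [err]
  push_cast
  ring

lemma exists_int_det_of_same_sign {α : ℝ} {p q : ℕ} (h : 0 < err α p * err α q) :
    ∃ z : ℤ, |err α p| * q - |err α q| * p = z := by
  obtain ⟨z, hz⟩ := exists_int_det α p q
  rcases mul_pos_iff.mp h with ⟨h1, h2⟩ | ⟨h1, h2⟩
  · exact ⟨z, by rw [abs_of_pos h1, abs_of_pos h2, hz]⟩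
  · exact ⟨-z, by rw [abs_of_neg h1, abs_of_neg h2]; push_cast; rw [← hz]; ring⟩

lemma exists_int_det_of_opp_sign {α : ℝ} {p q : ℕ} (h : err α p * err α q < 0) :
    ∃ z : ℤ, |err α p| * q + |err α q| * p = z := by
  obtain ⟨z, hz⟩ := exists_int_det α p q
  rcases mul_neg_iff.mp h with ⟨h1, h2⟩ | ⟨h1, h2⟩
  · exact ⟨z, by rw [abs_of_pos h1, abs_of_neg h2, ← hz]; ring⟩
  · exact ⟨-z, by rw [abs_of_neg h1, abs_of_pos h2]; push_cast; rw [← hz]; ring⟩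

lemma IsLastRecord.err_mul_err_neg {α : ℝ} (hα : Irrational α) {p q : ℕ}
    (h : IsLastRecord α p q) (hq : IsRecord α q) : err α p * err α q < 0 := by
  by_contra! hc
  have hp0 := err_ne_zero hα h.1.1
  have hq0 := err_ne_zero hα hq.1
  have hpos : 0 < err α p * err α q := lt_of_le_of_ne hc (mul_ne_zero hp0 hq0).symm
  have hlt := hq.2 p h.1.1 h.2.1
  have hpq := h.2.1
  have h1 := h.2.2 (q - p) (by omega) (by have := h.1.1; omega)
  have h2 := abs_err_le α (q - p) (round ((q : ℝ) * α) - round ((p : ℝ) * α))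
  have h3 : ((q - p : ℕ) : ℝ) * α - ((round ((q : ℝ) * α) - round ((p : ℝ) * α) : ℤ) : ℝ)
      = err α q - err α p := by
    rw [Nat.cast_sub hpq.le]; simp only [err]; push_cast; ring
  rw [h3] at h2
  have h4 := h1.trans h2
  rcases mul_pos_iff.mp hpos with ⟨h5, h6⟩ | ⟨h5, h6⟩
  · rw [abs_of_pos h5, abs_of_pos h6] at hlt
    rw [abs_of_pos h5, abs_of_neg (by linarith)] at h4
    linarith
  · rw [abs_of_neg h5, abs_of_neg h6] at hlt
    rw [abs_of_neg h5, abs_of_pos (by linarith)] at h4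
    linarith

lemma IsLastRecord.det_eq_one {α : ℝ} (hα : Irrational α) {p q : ℕ}
    (h : IsLastRecord α p q) (hq : IsRecord α q) :
    |err α p| * q + |err α q| * p = 1 := by
  obtain ⟨z, hz⟩ := exists_int_det_of_opp_sign (h.err_mul_err_neg hα hq)
  have h1 := h.abs_err_mul_le
  have hp1 : (1 : ℝ) ≤ p := by exact_mod_cast h.1.1
  have hpq : (p : ℝ) < q := by exact_mod_cast h.2.1
  have hlt := hq.2 p h.1.1 h.2.1
  have hq0 := abs_err_pos hα hq.1
  have h2 : |err α q| * p < |err α p| * q :=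
    mul_lt_mul'' hlt hpq hq0.le (by positivity)
  have h3 : 0 < |err α q| * p := by positivity
  have h4 : (0 : ℝ) < z := by linarith
  have h5 : (z : ℝ) < 2 := by linarith
  have h6 : z = 1 := by
    have : 0 < z := by exact_mod_cast h4
    have : z < 2 := by exact_mod_cast h5
    omega
  rw [hz, h6]; simp

/-- Three consecutive best approximation denominators satisfy the continued fraction
recursion, with an explicit formula for the partial quotient. -/
lemma IsLastRecord.exists_quotient {α : ℝ} (hα : Irrational α) {m p q : ℕ}
    (hm : IsLastRecord α m p) (hp : IsLastRecord α p q) (hq : IsRecord α q) :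
    ∃ c : ℕ, |err α m| * q = c + |err α q| * m ∧ q = c * p + m := by
  have s1 := hm.err_mul_err_neg hα hp.1
  have s2 := hp.err_mul_err_neg hα hq
  have s3 : 0 < err α m * err α q := by
    have h0 : 0 < err α p ^ 2 := by have := err_ne_zero hα hp.1.1; positivity
    have h1 := mul_pos_of_neg_of_neg s1 s2
    have h2 : err α m * err α p * (err α p * err α q) = err α p ^ 2 * (err α m * err α q) := by
      ring
    rw [h2] at h1
    exact pos_of_mul_pos_right h1 h0.le
  obtain ⟨z, hz⟩ := exists_int_det_of_same_sign s3
  have d1 := hm.det_eq_one hα hp.1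
  have d2 := hp.det_eq_one hα hq
  have h1 : (z : ℝ) * p = q - m := by
    rw [← hz]; linear_combination (q : ℝ) * d1 - (m : ℝ) * d2
  have hmq : m < q := hm.2.1.trans hp.2.1
  have h2 : z * p = q - m := by exact_mod_cast h1
  have hz0 : 0 ≤ z := by
    have hp1 := hp.1.1
    by_contra! hc
    have : z * p ≤ 0 := mul_nonpos_of_nonpos_of_nonneg hc.le (by positivity)
    omega
  lift z to ℕ using hz0
  refine ⟨z, by push_cast at hz; linarith, ?_⟩
  have h3 : (q : ℤ) = z * p + m := by linarith
  exact_mod_cast h3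

/-- If `a` lies above `b` just before a common discontinuity `q`, then `b` lies above `a`
just before the previous discontinuity `p` of `b`. -/
lemma abs_err_le_of_common_record {a b : ℝ} (ha : Irrational a) (hb : Irrational b)
    {q p m r s : ℕ} (hqa : IsRecord a q) (hqb : IsRecord b q) (hp : IsLastRecord b p q)
    (hm : IsLastRecord b m p) (hr : IsLastRecord a r q) (hs : IsLastRecord a s p)
    (hlt : |err b p| < |err a r|) : |err a s| ≤ |err b m| := by
  by_contra! hc
  obtain ⟨c, hc1, hc2⟩ := hm.exists_quotient hb hp hqb
  obtain ⟨u, hu, hur⟩ := exists_next_record ha hs.1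
  have hpu : p ≤ u := by
    by_contra! h
    exact absurd (hur.2 s hs.1.1 hu.2.1) (not_lt.mpr (hs.2.2 u hur.1 h))
  have hsq : s < q := hs.2.1.trans hp.2.1
  have huq : u ≤ q := by
    by_contra! h
    exact absurd (hqa.2 s hs.1.1 hsq) (not_lt.mpr (hu.2.2 q hqa.1 h))
  have hc1' : 1 ≤ c := by
    rcases Nat.eq_zero_or_pos c with h | h
    · rw [h] at hc2; have := hm.2.1; have := hp.2.1; omega
    · exact h
  have cR : (q : ℝ) = c * p + m := by exact_mod_cast hc2
  have ηa := abs_err_pos ha hqa.1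
  have ηb := abs_err_pos hb hqb.1
  have hqpos : (0 : ℝ) < q := by exact_mod_cast hqa.1
  have hspos : (0 : ℝ) < s := by exact_mod_cast hs.1.1
  have hmpos : (0 : ℝ) < m := by exact_mod_cast hm.1.1
  have hcR : (1 : ℝ) ≤ c := by exact_mod_cast hc1'
  have hmul : |err b m| * q < |err a s| * q := by gcongr
  have hbm : 0 < |err b q| * m := by positivity
  rcases huq.eq_or_lt with rfl | huq'
  · have h1 := hu.abs_err_mul_le
    linarith
  have hur' : u ≤ r := hr.le_of_isRecord hur huq'
  have d1 := hr.det_eq_one ha hqa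
  have d2 := hp.det_eq_one hb hqb
  have d3 := hu.det_eq_one ha hur
  have hη : |err a q| < |err b q| := by
    have h1 : |err b p| * q < |err a r| * q := by gcongr
    have h2 : |err a q| * r < |err b q| * p := by linarith
    have h3 : |err b q| * p ≤ |err b q| * r := by gcongr; exact_mod_cast hpu.trans hur'
    exact lt_of_mul_lt_mul_right (h2.trans_le h3) (by positivity)
  have hbig : ∀ z : ℤ, (c : ℝ) < z → (z : ℝ) * u ≤ q → False := by
    intro z h1 h2
    have h3 : (c : ℤ) + 1 ≤ z := by
      have : (c : ℤ) < z := by exact_mod_cast h1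
      omega
    have h4 : ((c : ℤ) + 1) * p ≤ z * u :=
      mul_le_mul h3 (by exact_mod_cast hpu) (by positivity) (by omega)
    have h5 : z * u ≤ q := by exact_mod_cast h2
    have h6 := hm.2.1
    have h7 : (q : ℤ) = c * p + m := by exact_mod_cast hc2
    have h8 : ((c : ℤ) + 1) * p = c * p + p := by ring
    omega
  rcases lt_or_gt_of_ne (mul_ne_zero (err_ne_zero ha hs.1.1) (err_ne_zero ha hqa.1)) with hsg | hsg
  · obtain ⟨z, hz⟩ := exists_int_det_of_opp_sign hsg
    refine hbig z ?_ ?_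
    · rw [← hz]
      have : 0 < |err a q| * s := by positivity
      linarith
    · have h1 : (z : ℝ) * u = q - s * (|err a u| * q - |err a q| * u) := by
        rw [← hz]; linear_combination (q : ℝ) * d3
      have h2 : |err a q| * u ≤ |err a u| * q :=
        mul_le_mul (hqa.2 u hur.1 huq').le (by exact_mod_cast huq) (by positivity) (by positivity)
      have h3 := mul_nonneg hspos.le (sub_nonneg.mpr h2)
      linarith
  · obtain ⟨z, hz⟩ := exists_int_det_of_same_sign hsg
    have hsg' : err a u * err a q < 0 := by
      have h1 := hu.err_mul_err_neg ha hur
      have h2 := mul_neg_of_neg_of_pos h1 hsg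
      have h3 : err a s * err a u * (err a s * err a q)
        = err a s ^ 2 * (err a u * err a q) := by ring
      rw [h3] at h2
      by_contra! h4
      have : 0 ≤ err a s ^ 2 * (err a u * err a q) := by positivity
      linarith
    obtain ⟨g, hg⟩ := exists_int_det_of_opp_sign hsg'
    have hg1 : (1 : ℝ) ≤ g := by
      have h0 : (0 : ℝ) < g := by rw [← hg]; have := abs_err_pos ha hur.1; positivity
      have h1 : 0 < g := by exact_mod_cast h0
      exact_mod_cast h1
    have hzu : (z : ℝ) * u = q - s * g := by
      rw [← hz, ← hg]; linear_combination (q : ℝ) * d3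
    have hsg1 : (s : ℝ) ≤ s * g := le_mul_of_one_le_right hspos.le hg1
    have hsr : (s : ℝ) ≤ r := by exact_mod_cast hs.2.1.le.trans (hpu.trans hur')
    have hηs : |err a q| * s < 1 := by
      have h1 : |err a q| * s ≤ |err a q| * r := by gcongr
      have h2 : 0 < |err a r| * q := mul_pos (abs_err_pos ha hr.1.1) hqpos
      linarith
    have hcz : (c : ℤ) ≤ z := by
      have h1 : (c : ℝ) < z + 1 := by linarith
      have h2 : (c : ℤ) < z + 1 := by exact_mod_cast h1
      omega
    have hczR : (c : ℝ) ≤ z := by exact_mod_cast hcz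
    have hsm : (s : ℝ) ≤ m := by
      have h1 : (c : ℝ) * p ≤ z * u := by
        have h2 : (p : ℝ) ≤ u := by exact_mod_cast hpu
        exact mul_le_mul hczR h2 (by positivity) (by linarith)
      linarith
    refine hbig z ?_ ?_
    · have h1 : |err a q| * s < |err b q| * m := mul_lt_mul hη hsm hspos ηb.le
      linarith
    · linarith

lemma abs_err_sub_of_common_pred {a b : ℝ} (ha : Irrational a) (hb : Irrational b) :
    ∀ q p : ℕ, IsRecord a q → IsRecord b q → IsLastRecord a p q → IsLastRecord b p q →
      |(|err a q| - |err b q|)| = q * |(|err a 1| - |err b 1|)| := by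
  intro q
  induction q using Nat.strong_induction_on with
  | _ q ih =>
    intro p hqa hqb hpa hpb
    have key : |(|err a p| - |err b p|)| * q = |(|err a q| - |err b q|)| * p := by
      have d1 := hpa.det_eq_one ha hqa
      have d2 := hpb.det_eq_one hb hqb
      have h1 : (|err a p| - |err b p|) * q = -((|err a q| - |err b q|) * p) := by
        linear_combination d1 - d2
      have h2 := congrArg abs h1
      rwa [abs_neg, abs_mul, abs_mul, Nat.abs_cast, Nat.abs_cast] at h2
    have hp0 : (p : ℝ) ≠ 0 := by have := hpa.1.1; positivity
    rcases eq_or_lt_of_le hpa.1.1 with h1 | h1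
    · rw [← h1] at key
      rw [Nat.cast_one] at key
      linarith
    · obtain ⟨m, hma⟩ := exists_isLastRecord a (t := p) (by omega)
      obtain ⟨m', hmb⟩ := exists_isLastRecord b (t := p) (by omega)
      obtain ⟨c, -, hc⟩ := hma.exists_quotient ha hpa hqa
      obtain ⟨c', -, hc'⟩ := hmb.exists_quotient hb hpb hqb
      have e1 : q % p = m := by
        rw [hc, Nat.mul_add_mod_self_right, Nat.mod_eq_of_lt hma.2.1]
      have e2 : q % p = m' := by
        rw [hc', Nat.mul_add_mod_self_right, Nat.mod_eq_of_lt hmb.2.1]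
      have e3 : m' = m := by rw [← e1, e2]
      subst e3
      rw [ih p hpa.2.1 m' hpa.1 hpb.1 hma hmb] at key
      apply mul_right_cancel₀ hp0
      linarith

lemma psi_eq_abs_err {α : ℝ} {p t : ℕ} (h : IsLastRecord α p t) {x : ℝ} (h1 : (p : ℝ) ≤ x)
    (h2 : x < t) : psi α x = |err α p| := by
  apply IsLeast.csInf_eq
  constructor
  · exact ⟨(p : ℤ), ⟨by exact_mod_cast h.1.1, by exact_mod_cast h1⟩, by simp [distToInt, err]⟩
  · rintro _ ⟨q, ⟨hq1, hq2⟩, rfl⟩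
    lift q to ℕ using by omega
    have hq3 : q < t := by
      have : ((q : ℤ) : ℝ) < t := hq2.trans_lt h2
      exact_mod_cast this
    have := h.2.2 q (by exact_mod_cast hq1) hq3
    simpa [distToInt, err] using this

lemma psi_anti (α : ℝ) {x y : ℝ} (hx : 1 ≤ x) (hxy : x ≤ y) : psi α y ≤ psi α x := by
  apply csInf_le_csInf
  · exact ⟨0, by rintro _ ⟨q, -, rfl⟩; exact abs_nonneg _⟩
  · exact ⟨_, 1, ⟨le_rfl, by simpa using hx⟩, rfl⟩
  · exact Set.image_mono fun q hq => ⟨hq.1, hq.2.trans hxy⟩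

lemma psi_record {α : ℝ} (hα : Irrational α) {q : ℕ} (hq : IsRecord α q) :
    psi α q = |err α q| := by
  obtain ⟨r, hr, -⟩ := exists_next_record hα hq
  exact psi_eq_abs_err hr le_rfl (by exact_mod_cast hr.2.1)

lemma exists_record_of_not_continuousAt {α t : ℝ} (ht : 1 < t)
    (h : ¬ ContinuousAt (psi α) t) : ∃ q : ℕ, (q : ℝ) = t ∧ IsRecord α q := by
  by_contra! hc
  apply h
  obtain ⟨N, hN⟩ : ∃ N : ℕ, ⌈t⌉₊ = N + 1 :=
    Nat.exists_eq_succ_of_ne_zero (Nat.ceil_pos.mpr (by linarith)).ne'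
  have hNt : (N : ℝ) < t := Nat.lt_ceil.mp (by omega)
  have htN : t ≤ (N + 1 : ℕ) := hN ▸ Nat.le_ceil t
  have hN1 : 1 ≤ N := by
    by_contra! h0
    have : N = 0 := by omega
    subst this
    norm_num at htN
    linarith
  obtain ⟨p, hp⟩ := exists_isLastRecord α (t := N + 1) (by omega)
  have hpN : (p : ℝ) ≤ N := by exact_mod_cast Nat.lt_succ_iff.mp hp.2.1
  have main : ∃ M : ℕ, t < M ∧ IsLastRecord α p M := by
    rcases htN.lt_or_eq with hlt | heq
    · exact ⟨N + 1, hlt, hp⟩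
    · have hnr := hc (N + 1) heq.symm
      simp only [IsRecord, not_and, not_forall, not_lt] at hnr
      obtain ⟨s, hs1, hs2, hs3⟩ := hnr (by omega)
      refine ⟨N + 2, by rw [heq]; push_cast; linarith, hp.1, by have := hp.2.1; omega, ?_⟩
      intro r hr1 hr2
      rcases Nat.lt_succ_iff_lt_or_eq.mp hr2 with h1 | rfl
      · exact hp.2.2 r hr1 h1
      · exact (hp.2.2 s hs1 hs2).trans hs3
  obtain ⟨M, hM, hpM⟩ := main
  have hev : psi α =ᶠ[nhds t] fun _ => |err α p| := by
    filter_upwards [Ioo_mem_nhds hNt hM] with x hx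
    exact psi_eq_abs_err hpM (hpN.trans hx.1.le) hx.2
  exact continuousAt_const.congr hev.symm

lemma exists_isOrderVec {n : ℕ} (α : Fin n → ℝ) (t : ℝ)
    (h : ∀ i j : Fin n, i ≠ j → psi (α i) t ≠ psi (α j) t) : ∃ v, IsOrderVec α t v := by
  let f : Fin n → ℝ := fun i => -psi (α i) t
  refine ⟨Tuple.sort f, (Tuple.sort f).bijective, fun p q hpq => ?_⟩
  have h1 := Tuple.monotone_sort f hpq.le
  have h2 := h (Tuple.sort f p) (Tuple.sort f q) fun e => hpq.ne ((Tuple.sort f).injective e)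
  simp only [Function.comp, f, neg_le_neg_iff] at h1
  exact lt_of_le_of_ne h1 h2.symm

lemma IsOrderVec.psi_lt {n : ℕ} {α : Fin n → ℝ} {t t' : ℝ} {v : Fin n → Fin n}
    (h : IsOrderVec α t v) (h' : IsOrderVec α t' v) {i j : Fin n}
    (hij : psi (α i) t < psi (α j) t) : psi (α i) t' < psi (α j) t' := by
  obtain ⟨p, rfl⟩ := h.1.2 i
  obtain ⟨q, rfl⟩ := h.1.2 j
  rcases lt_trichotomy p q with hpq | rfl | hpq
  · exact absurd (h.2 p q hpq) (not_lt.mpr hij.le)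
  · exact absurd hij (lt_irrefl _)
  · exact h'.2 q p hpq

lemma eventually_occursInfinitely {n : ℕ} (α : Fin n → ℝ) :
    ∀ᶠ t in Filter.atTop, ∀ v, IsOrderVec α t v → OccursInfinitely α v := by
  rw [Filter.eventually_all]
  intro v
  by_cases hv : OccursInfinitely α v
  · exact Filter.Eventually.of_forall fun _ _ => hv
  · simp only [OccursInfinitely, not_forall, not_exists, not_and] at hv
    obtain ⟨T, hT⟩ := hv
    filter_upwards [Filter.eventually_gt_atTop T] with t ht h
    exact absurd h (hT t ht)

lemma eventually_no_common_pred {a b : ℝ} (ha : Irrational a) (hb : Irrational b)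
    (h : ∀ᶠ t in Filter.atTop, psi a t ≠ psi b t) :
    ∀ᶠ q : ℕ in Filter.atTop, IsRecord a q → IsRecord b q →
      ∀ p, IsLastRecord a p q → ¬ IsLastRecord b p q := by
  rcases eq_or_ne |err a 1| |err b 1| with he | he
  · filter_upwards [tendsto_natCast_atTop_atTop.eventually h] with q hq hqa hqb p hpa hpb
    have h1 := abs_err_sub_of_common_pred ha hb q p hqa hqb hpa hpb
    rw [he, sub_self, abs_zero, mul_zero, abs_eq_zero, sub_eq_zero] at h1
    exact hq (by rw [psi_record ha hqa, psi_record hb hqb, h1])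
  · have hpos : 0 < |(|err a 1| - |err b 1|)| := abs_pos.mpr (sub_ne_zero.mpr he)
    filter_upwards [tendsto_natCast_atTop_atTop.eventually
      (Filter.eventually_gt_atTop (1 / |(|err a 1| - |err b 1|)|))] with q hq hqa hqb p hpa hpb
    have h1 := abs_err_sub_of_common_pred ha hb q p hqa hqb hpa hpb
    rw [div_lt_iff₀ hpos, ← h1] at hq
    have h2 := abs_err_le_half a q
    have h3 := abs_err_le_half b q
    have h4 := abs_nonneg (err a q)
    have h5 := abs_nonneg (err b q)
    exact absurd hq (not_lt.mpr (abs_le.mpr ⟨by linarith, by linarith⟩))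

/-- If all functions indexed by `J` drop at `q`, one of them is the largest just before `q`.
Its order relative to each other one distinguishes the order vectors just before the previous
drops of the others from each other and from the order vector just before `q`. -/
lemma card_le_kAlpha_of_common_record {n : ℕ} {α : Fin n → ℝ} (hirr : ∀ i, Irrational (α i))
    {T : ℕ} (hne : ∀ t : ℝ, T ≤ t → ∀ i j : Fin n, i ≠ j → psi (α i) t ≠ psi (α j) t)
    (hocc : ∀ t : ℝ, T ≤ t → ∀ v, IsOrderVec α t v → OccursInfinitely α v)
    {J : Set (Fin n)} (hJ : J.Nonempty) {q : ℕ} (hq : ∀ j ∈ J, IsRecord (α j) q)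
    (hlarge : ∀ j, ∃ r, T + 2 ≤ r ∧ r < q ∧ IsRecord (α j) r)
    (hpred : ∀ i ∈ J, ∀ j ∈ J, i ≠ j →
      ∀ p, IsLastRecord (α i) p q → ¬ IsLastRecord (α j) p q) :
    Nat.card J ≤ kAlpha α := by
  classical
  have hq2 : T + 3 ≤ q := by
    obtain ⟨j, -⟩ := hJ
    obtain ⟨r, h1, h2, -⟩ := hlarge j
    omega
  choose Q hQ using fun j => exists_isLastRecord (α j) (t := q) (by omega)
  have hQT : ∀ j, T + 2 ≤ Q j := fun j => by
    obtain ⟨r, h1, h2, h3⟩ := hlarge j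
    exact h1.trans ((hQ j).le_of_isRecord h3 h2)
  have hQq : ∀ j, Q j < q := fun j => (hQ j).2.1
  have hval : ∀ j (s : ℕ), Q j ≤ s → s < q → psi (α j) s = |err (α j) (Q j)| := fun j s h1 h2 =>
    psi_eq_abs_err (hQ j) (by exact_mod_cast h1) (by exact_mod_cast h2)
  obtain ⟨a, haJ, hmax⟩ := Set.exists_max_image J (fun j => |err (α j) (Q j)|) J.toFinite hJ
  have htop : ∀ b ∈ J, b ≠ a → |err (α b) (Q b)| < |err (α a) (Q a)| := fun b hb hba => by
    refine lt_of_le_of_ne (hmax b hb) ?_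
    have h1 := hne ((q - 1 : ℕ) : ℝ) (by exact_mod_cast (by omega : T ≤ q - 1)) b a hba
    rwa [hval b (q - 1) (by have := hQq b; omega) (by omega),
      hval a (q - 1) (by have := hQq a; omega) (by omega)] at h1
  have hbelow : ∀ b ∈ J, b ≠ a → ∀ s : ℕ, Q b ≤ s → s < q → psi (α b) s < psi (α a) s := by
    intro b hb hba s h1 h2
    have hs : 1 ≤ s := by have := hQT b; omega
    have h3 : psi (α a) ((q - 1 : ℕ) : ℝ) ≤ psi (α a) s :=
      psi_anti _ (by exact_mod_cast hs) (by exact_mod_cast (by omega : s ≤ q - 1))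
    rw [hval a (q - 1) (by have := hQq a; omega) (by omega)] at h3
    rw [hval b s h1 h2]
    exact (htop b hb hba).trans_le h3
  have habove : ∀ b ∈ J, b ≠ a →
      psi (α a) ((Q b - 1 : ℕ) : ℝ) < psi (α b) ((Q b - 1 : ℕ) : ℝ) := by
    intro b hb hba
    have hb2 := hQT b
    obtain ⟨m, hm⟩ := exists_isLastRecord (α b) (t := Q b) (by omega)
    obtain ⟨s, hs⟩ := exists_isLastRecord (α a) (t := Q b) (by omega)
    have h1 := abs_err_le_of_common_record (hirr a) (hirr b) (hq a haJ) (hq b hb) (hQ b) hm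
      (hQ a) hs (htop b hb hba)
    have hlt : ((Q b - 1 : ℕ) : ℝ) < Q b := by exact_mod_cast (by omega : Q b - 1 < Q b)
    rw [← psi_eq_abs_err hs (x := ((Q b - 1 : ℕ) : ℝ))
        (by exact_mod_cast (by have := hs.2.1; omega : s ≤ Q b - 1)) hlt,
      ← psi_eq_abs_err hm (x := ((Q b - 1 : ℕ) : ℝ))
        (by exact_mod_cast (by have := hm.2.1; omega : m ≤ Q b - 1)) hlt] at h1
    exact lt_of_le_of_ne h1
      (hne _ (by exact_mod_cast (by omega : T ≤ Q b - 1)) a b hba.symm)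
  let τ : Fin n → ℕ := fun j => if j = a then q - 1 else Q j - 1
  have hτT : ∀ j, T ≤ τ j := fun j => by
    have := hQT j
    simp only [τ]
    split_ifs <;> omega
  have hτT' : ∀ j, (T : ℝ) ≤ τ j := fun j => by exact_mod_cast hτT j
  choose v hv using fun j => exists_isOrderVec α (τ j) (hne _ (hτT' j))
  have hdist : ∀ b ∈ J, b ≠ a → ∀ c, Q b ≤ τ c → τ c < q → v b ≠ v c := by
    intro b hb hba c h1 h2 he
    have hb1 := hv b
    have hτb : τ b = Q b - 1 := if_neg hba
    rw [he, hτb] at hb1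
    exact lt_asymm (hb1.psi_lt (hv c) (habove b hb hba)) (hbelow b hb hba _ h1 h2)
  have hτa : τ a = q - 1 := if_pos rfl
  have hinj : ∀ b ∈ J, ∀ c ∈ J, v b = v c → b = c := by
    intro b hb c hc he
    by_contra hbc
    by_cases hba : b = a
    · subst hba
      have hcb : c ≠ b := Ne.symm hbc
      exact hdist c hc hcb b (by have := hQq c; omega) (by omega) he.symm
    by_cases hca : c = a
    · subst hca
      exact hdist b hb hba c (by have := hQq b; omega) (by omega) he
    have hτb : τ b = Q b - 1 := if_neg hba
    have hτc : τ c = Q c - 1 := if_neg hca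
    have hb3 := hQq b
    have hc3 := hQq c
    rcases lt_trichotomy (Q b) (Q c) with h | h | h
    · exact hdist b hb hba c (by omega) (by omega) he
    · exact hpred b hb c hc hbc _ (hQ b) (h ▸ hQ c)
    · exact hdist c hc hca b (by omega) (by omega) he.symm
  refine Nat.card_le_card_of_injective
    (fun j : J => (⟨v j, hocc _ (hτT' j) _ (hv j)⟩ : {v | OccursInfinitely α v})) ?_
  intro b c hbc
  exact Subtype.ext (hinj b b.2 c c.2 (congrArg Subtype.val hbc))

/-- **Lemma 7 of [Rud22].** Eventually, at most `k(α)` of the functions `ψ_{α_j}` can be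
discontinuous at a common point. -/
theorem stmt5 (n : ℕ) (α : Fin n → ℝ) (hirr : ∀ i, Irrational (α i))
    (hind : PairwiseIndependent α) :
    ∃ T : ℝ, 0 < T ∧ ∀ t : ℝ, T < t →
      Nat.card {j : Fin n // ¬ ContinuousAt (psi (α j)) t} ≤ kAlpha α := by
  classical
  obtain ⟨T₀, -, hT₀⟩ := hind
  obtain ⟨T₁, hT₁⟩ := Filter.eventually_atTop.mp (eventually_occursInfinitely α)
  obtain ⟨T, hT⟩ := exists_nat_ge (max T₀ T₁)
  have hne : ∀ t : ℝ, T ≤ t → ∀ i j : Fin n, i ≠ j → psi (α i) t ≠ psi (α j) t :=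
    fun t ht => hT₀ t ((le_max_left _ _).trans (hT.trans ht))
  have hocc : ∀ t : ℝ, T ≤ t → ∀ v, IsOrderVec α t v → OccursInfinitely α v :=
    fun t ht => hT₁ t ((le_max_right _ _).trans (hT.trans ht))
  have hpred : ∀ᶠ q : ℕ in Filter.atTop, ∀ i j : Fin n, i ≠ j → IsRecord (α i) q →
      IsRecord (α j) q → ∀ p, IsLastRecord (α i) p q → ¬ IsLastRecord (α j) p q := by
    simp only [Filter.eventually_all]
    intro i j hij
    exact eventually_no_common_pred (hirr i) (hirr j)
      (Filter.eventually_atTop.mpr ⟨T, fun t ht => hne t ht i j hij⟩)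
  have hlarge : ∀ᶠ q : ℕ in Filter.atTop,
      ∀ j, ∃ r, T + 2 ≤ r ∧ r < q ∧ IsRecord (α j) r := by
    rw [Filter.eventually_all]
    intro j
    obtain ⟨r, hr, hrec⟩ := exists_record_ge (hirr j) (T + 2)
    filter_upwards [Filter.eventually_gt_atTop r] with q hq
    exact ⟨r, hr, hq, hrec⟩
  obtain ⟨N, hN⟩ := Filter.eventually_atTop.mp (hpred.and hlarge)
  refine ⟨N + 1, by positivity, fun t ht => ?_⟩
  rcases Set.eq_empty_or_nonempty {j : Fin n | ¬ ContinuousAt (psi (α j)) t} with he | hJ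
  · have : Nat.card {j : Fin n | ¬ ContinuousAt (psi (α j)) t} = 0 := by simp [he]
    exact this.le.trans (Nat.zero_le _)
  have hN0 : (0 : ℝ) ≤ N := N.cast_nonneg
  have hrec : ∀ j ∈ {j : Fin n | ¬ ContinuousAt (psi (α j)) t},
      ∃ q : ℕ, (q : ℝ) = t ∧ IsRecord (α j) q :=
    fun j hj => exists_record_of_not_continuousAt (by linarith) hj
  obtain ⟨q, hqt, -⟩ := hrec _ hJ.some_mem
  have hq : ∀ j ∈ {j : Fin n | ¬ ContinuousAt (psi (α j)) t}, IsRecord (α j) q := fun j hj => by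
    obtain ⟨q', h1, h2⟩ := hrec j hj
    have : q' = q := by exact_mod_cast h1.trans hqt.symm
    exact this ▸ h2
  have hNq : N ≤ q := by
    have : (N : ℝ) ≤ q := by linarith
    exact_mod_cast this
  exact card_le_kAlpha_of_common_record hirr hne hocc hJ hq (hN q hNq).2
    fun i hi j hj hij => (hN q hNq).1 i j hij (hq i hi) (hq j hj)
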